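/- For every ε > 0 there exists a constant C > 0 such that for all f, g, h whose spacetime Fourier transforms f̂, ĝ, ĥ are nonnegative, the following three estimates hold (with ξ = ξ₁+ξ₂): (i) I_{m}(f̂,ĝ,ĥ) ≤ C ‖f‖_{L²(ℝ²)} ‖g‖_{X_{0,1/2+ε}} ‖h‖_{X⁻_{0,1/2+ε}} with weight m(ξ₁,ξ₂) = |ξ|^{1/2}; (ii) I_{m}(f̂,ĝ,ĥ) ≤ C ‖f‖_{Y_{0,1/2+ε}} ‖g‖_{L²(ℝ²)} ‖h‖_{X⁻_{0,1/2+ε}} with weight m(ξ₁,ξ₂) = |3ξ² − 2ξ₂|^{1/2}; (iii) I_{m}(f̂,ĝ,ĥ) ≤ C ‖f‖_{Y_{0,1/2+ε}} ‖g‖_{X_{0,1/2+ε}} ‖h‖_{L²(ℝ²)} with weight m(ξ₁,ξ₂) = |3ξ² + 2ξ₁|^{1/2}. -/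

import Mathlib

open MeasureTheory Real Set
open scoped ENNReal NNReal

noncomputable section

/-- Spacetime Fourier transform of `f : ℝ × ℝ → ℂ` (`p.1` = space frequency ξ, `p.2` = time frequency τ). -/
def FT2 (f : ℝ × ℝ → ℂ) : ℝ × ℝ → ℂ :=
  fun p => ∫ q : ℝ × ℝ,
    Complex.exp (-(2 * Real.pi * (q.1 * p.1 + q.2 * p.2)) * Complex.I) • f q

/-- Japanese bracket `⟨a⟩ = (1+a²)^{1/2}`. -/
def jb (a : ℝ) : ℝ := Real.sqrt (1 + a ^ 2)

/-- The Bourgain norm `‖f‖_{X_{s,b}(φ)}`, as an `ℝ≥0∞`-valued quantity. -/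
def XNorm (φ : ℝ → ℝ) (s b : ℝ) (f : ℝ × ℝ → ℂ) : ℝ≥0∞ :=
  (∫⁻ p : ℝ × ℝ,
    ENNReal.ofReal (jb p.1 ^ (2 * s) * jb (p.2 + φ p.1) ^ (2 * b) * ‖FT2 f p‖ ^ 2)) ^ (1/2 : ℝ)

/-- Schrödinger phase `φ(ξ) = ξ²`. -/
def SchPhase : ℝ → ℝ := fun ξ => ξ ^ 2

/-- Conjugate Schrödinger phase `φ(ξ) = -ξ²`. -/
def SchPhaseNeg : ℝ → ℝ := fun ξ => -ξ ^ 2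

/-- Airy (KdV) phase `φ(ξ) = -ξ³`. -/
def AiryPhase : ℝ → ℝ := fun ξ => -ξ ^ 3

/-- `f` has a nonnegative (real-valued) spacetime Fourier transform. -/
def HasNonnegFT (f : ℝ × ℝ → ℂ) : Prop :=
  ∀ p, (FT2 f p).im = 0 ∧ 0 ≤ (FT2 f p).re

/-- The weighted trilinear functional `I_m(f̂,ĝ,ĥ)`, applied here directly to
the Fourier transforms `F = f̂`, `G = ĝ`, `H = ĥ` (assumed nonnegative). -/
def Itri (m : ℝ → ℝ → ℝ) (F G H : ℝ × ℝ → ℂ) : ℝ≥0∞ :=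
  ∫⁻ q : (ℝ × ℝ) × (ℝ × ℝ),
    ENNReal.ofReal
      (m q.1.1 q.2.1 * (F (q.1.1 + q.2.1, q.1.2 + q.2.2)).re * (G q.1).re * (H q.2).re)

/-- Partial derivative in the spatial variable `x` (first coordinate). -/
def partialX (f : ℝ × ℝ → ℂ) : ℝ × ℝ → ℂ :=
  fun p => deriv (fun x => f (x, p.2)) p.1

/-- Multiplication by the rescaled time cutoff, `(ψ(t/δ)f)(x,t) = ψ(t/δ) f(x,t)`. -/
def timeCut (ψ : ℝ → ℝ) (δ : ℝ) (f : ℝ × ℝ → ℂ) : ℝ × ℝ → ℂ :=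
  fun p => (ψ (p.2 / δ) : ℂ) * f p

/-- `ψ` is a fixed even smooth bump, `0 ≤ ψ ≤ 1`, `ψ ≡ 1` on `[-1,1]`, supp ψ ⊆ `[-2,2]`. -/
def IsTimeBump (ψ : ℝ → ℝ) : Prop :=
  ContDiff ℝ (⊤ : ℕ∞) ψ ∧ HasCompactSupport ψ ∧ (∀ t, ψ (-t) = ψ t) ∧
  (∀ t, 0 ≤ ψ t ∧ ψ t ≤ 1) ∧ (∀ t ∈ Set.Icc (-1 : ℝ) 1, ψ t = 1) ∧
  Function.support ψ ⊆ Set.Icc (-2 : ℝ) 2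

/-- `m` is an admissible symbol `m_{N,s}` for the smoothing operator `I_{N,s}`. -/
def IsISymbol (N s : ℝ) (m : ℝ → ℝ) : Prop :=
  ContDiff ℝ (⊤ : ℕ∞) m ∧ (∀ ξ, m (-ξ) = m ξ) ∧
  (∀ ξ, 0 < m ξ ∧ m ξ ≤ 1) ∧
  (∀ ξ η, |ξ| ≤ |η| → m η ≤ m ξ) ∧
  (∀ ξ, |ξ| ≤ N → m ξ = 1) ∧
  (∀ ξ, 2 * N ≤ |ξ| → m ξ = N ^ (1 - s) * |ξ| ^ (s - 1))

/-- Inverse spacetime Fourier transform. -/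
def invFT2 (f : ℝ × ℝ → ℂ) : ℝ × ℝ → ℂ :=
  fun p => ∫ q : ℝ × ℝ,
    Complex.exp ((2 * Real.pi * (q.1 * p.1 + q.2 * p.2)) * Complex.I) • f q

/-- The Fourier multiplier operator (in `x`) with symbol `m(ξ)`. -/
def Iop (m : ℝ → ℝ) (f : ℝ × ℝ → ℂ) : ℝ × ℝ → ℂ :=
  invFT2 (fun q => (m q.1 : ℂ) * FT2 f q)

/-- The restricted Bourgain norm `‖f‖_{X^E_{s,b}(φ)}`. -/
def XRestNorm (φ : ℝ → ℝ) (s b : ℝ) (E : Set ℝ) (f : ℝ × ℝ → ℂ) : ℝ≥0∞ :=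
  ⨅ F ∈ {F : ℝ × ℝ → ℂ | XNorm φ s b F < ⊤ ∧ ∀ x t, t ∈ E → F (x, t) = f (x, t)},
    XNorm φ s b F

open FourierTransform
open scoped SchwartzMap

theorem planch {E : Type*} [NormedAddCommGroup E] [MeasurableSpace E] [BorelSpace E] [InnerProductSpace ℝ E] [FiniteDimensional ℝ E] (f : E → ℂ) (hf : Integrable f) (h2 : MemLp f 2) :
   eLpNorm (𝓕 f) 2 volume = eLpNorm f 2 volume := by
  have hcont : Continuous (𝓕 f) := VectorFourier.fourierIntegral_continuous Real.continuous_fourierChar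
    (innerSL ℝ).continuous₂ hf
  have key : (𝓕 (h2.toLp f) : Lp (α := E) ℂ 2 volume) =ᵐ[volume] 𝓕 f := by
    apply ae_eq_of_integral_contDiff_smul_eq
    · exact (Lp.memLp _).locallyIntegrable (by norm_num)
    · exact hcont.locallyIntegrable
    intro g hg hgc
    have hgs : ContDiff ℝ (⊤:ℕ∞) (fun x => (g x : ℂ)) := Complex.ofRealCLM.contDiff.comp hg
    have hgc' : HasCompactSupport (fun x => (g x : ℂ)) := hgc.comp_left (g := fun x : ℝ => (x:ℂ)) (by simp)
    let G : 𝓢(E, ℂ) := hgc'.toSchwartzMap hgs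
    have h1 := congrArg (fun T => T G) (Lp.fourier_toTemperedDistribution_eq (h2.toLp f))
    simp only [TemperedDistribution.fourier_apply, Lp.toTemperedDistribution_apply] at h1
    have h3 := VectorFourier.integral_fourierIntegral_smul_eq_flip (μ := volume) (ν := volume) (L := innerₗ E) Real.continuous_fourierChar (by simpa using continuous_inner) G.integrable hf
    have e1 : ∫ x, g x • (𝓕 (h2.toLp f) : Lp (α := E) ℂ 2 volume) x = ∫ x, G x • (𝓕 (h2.toLp f) : Lp (α := E) ℂ 2 volume) x := by
      congr
    have e2 : ∫ x, g x • 𝓕 f x = ∫ x, G x • 𝓕 f x := by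
      congr
    rw [e1, e2, ← h1]
    have e3 : ∫ x, (𝓕 G) x • (h2.toLp f) x = ∫ x, (𝓕 G) x • f x := by
      apply integral_congr_ae
      filter_upwards [h2.coeFn_toLp] with x hx
      rw [hx]
    rw [e3]
    rw [flip_innerₗ] at h3
    exact h3
  rw [← eLpNorm_congr_ae key, ← eLpNorm_congr_ae h2.coeFn_toLp]
  have := Lp.norm_fourier_eq (h2.toLp f)
  rw [Lp.norm_def, Lp.norm_def] at this
  exact (ENNReal.toReal_eq_toReal_iff' (Lp.eLpNorm_ne_top _) (Lp.eLpNorm_ne_top _)).1 this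


theorem FT2_eq (f : ℝ × ℝ → ℂ) (p : ℝ × ℝ) :
    FT2 f p = 𝓕 (fun x : WithLp 2 (ℝ × ℝ) => f (WithLp.ofLp x)) (WithLp.toLp 2 p) := by
  rw [Real.fourier_eq']
  have := (WithLp.volume_preserving_ofLp ℝ ℝ).integral_comp (MeasurableEquiv.toLp 2 (ℝ × ℝ)).symm.measurableEmbedding (fun q : ℝ × ℝ => Complex.exp (-(2 * Real.pi * (q.1 * p.1 + q.2 * p.2)) * Complex.I) • f q)
  unfold FT2
  rw [← this]
  congr 1
  ext x
  congr 2
  simp only [WithLp.prod_inner_apply]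
  simp
  ring

theorem FT2_zero (f : ℝ × ℝ → ℂ) (hf : ¬ Integrable f) : FT2 f = 0 := by
  ext p
  unfold FT2
  apply integral_undef
  intro h
  apply hf
  have h2 := h.bdd_mul (c := 1) (f := fun q : ℝ × ℝ => Complex.exp (((2 * Real.pi * (q.1 * p.1 + q.2 * p.2) : ℝ) : ℂ) * Complex.I))
    (Continuous.aestronglyMeasurable (by fun_prop))
    (.of_forall fun q => (Complex.norm_exp_ofReal_mul_I _).le)
  refine h2.congr (.of_forall fun q => ?_)
  simp only [smul_eq_mul]
  rw [← mul_assoc, ← Complex.exp_add]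
  push_cast
  rw [show (2 * (π:ℂ) * (q.1 * p.1 + q.2 * p.2) * Complex.I + -(2 * (π:ℂ) * (q.1 * p.1 + q.2 * p.2)) * Complex.I) = 0 by ring]
  simp

theorem FT2_cont (f : ℝ × ℝ → ℂ) : Continuous (FT2 f) := by
  by_cases hf : Integrable f
  · apply continuous_of_dominated (bound := fun q => ‖f q‖)
    · intro p
      have hc : Continuous (fun q : ℝ × ℝ => Complex.exp (-(2 * Real.pi * (q.1 * p.1 + q.2 * p.2)) * Complex.I)) := by fun_prop
      exact hc.aestronglyMeasurable.smul hf.1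
    · intro p
      refine .of_forall fun q => ?_
      rw [norm_smul]
      have : ‖Complex.exp (-(2 * Real.pi * (q.1 * p.1 + q.2 * p.2)) * Complex.I)‖ = 1 := by
        have := Complex.norm_exp_ofReal_mul_I (-(2 * Real.pi * (q.1 * p.1 + q.2 * p.2)))
        push_cast at this
        exact this
      rw [this, one_mul]
    · exact hf.norm
    · refine .of_forall fun q => ?_
      fun_prop
  · rw [FT2_zero f hf]; exact continuous_const

theorem FT2_planch (f : ℝ × ℝ → ℂ) : eLpNorm (FT2 f) 2 volume ≤ eLpNorm f 2 volume := by
  by_cases hf : Integrable f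
  swap
  · rw [FT2_zero f hf]; simp
  by_cases h2 : MemLp f 2 volume
  swap
  · have : eLpNorm f 2 volume = ⊤ := by
      by_contra h
      exact h2 ⟨hf.1, lt_top_iff_ne_top.2 h⟩
    rw [this]; exact le_top
  have mp := WithLp.volume_preserving_ofLp ℝ ℝ
  have mp' := WithLp.volume_preserving_toLp ℝ ℝ
  have h := planch (fun x : WithLp 2 (ℝ × ℝ) => f (WithLp.ofLp x)) (mp.integrable_comp_of_integrable hf) (h2.comp_measurePreserving mp)
  have h' : FT2 f = 𝓕 (fun x : WithLp 2 (ℝ × ℝ) => f (WithLp.ofLp x)) ∘ WithLp.toLp 2 := by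
    ext p; exact FT2_eq f p
  have hc : 𝓕 (fun x : WithLp 2 (ℝ × ℝ) => f (WithLp.ofLp x)) = FT2 f ∘ WithLp.ofLp := by
    ext x
    simp [FT2_eq]
  rw [hc, eLpNorm_comp_measurePreserving (FT2_cont f).aestronglyMeasurable mp] at h
  rw [h]
  exact (eLpNorm_comp_measurePreserving hf.1 mp).le

theorem poly_piece (a b c d : ℝ) (S : Set ℝ) (hS : MeasurableSet S)
    (hinj : InjOn (fun x => a * x ^ 3 + b * x ^ 2 + c * x + d) S) (κ : ℝ → ℝ≥0∞) :
    ∫⁻ x in S, ENNReal.ofReal |3 * a * x ^ 2 + 2 * b * x + c| *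
      κ (a * x ^ 3 + b * x ^ 2 + c * x + d) ≤ ∫⁻ x, κ x := by
  have hd : ∀ x ∈ S, HasDerivWithinAt (fun x => a * x ^ 3 + b * x ^ 2 + c * x + d)
      (3 * a * x ^ 2 + 2 * b * x + c) S x := by
    intro x _
    apply HasDerivAt.hasDerivWithinAt
    have := ((((hasDerivAt_pow 3 x).const_mul a).add ((hasDerivAt_pow 2 x).const_mul b)).add
      ((hasDerivAt_id x).const_mul c)).add_const d
    convert this using 1
    simp; ring
  have := lintegral_image_eq_lintegral_abs_deriv_mul hS hd hinj κ
  rw [← this]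
  exact setLIntegral_le_lintegral _ _

theorem poly_inj_aux (a b c d x y : ℝ) (hxy : x < y)
    (h : a * x ^ 3 + b * x ^ 2 + c * x + d = a * y ^ 3 + b * y ^ 2 + c * y + d) :
    a * (x ^ 2 + x * y + y ^ 2) + b * (x + y) + c = 0 := by
  have h1 : (y - x) * (a * (x ^ 2 + x * y + y ^ 2) + b * (x + y) + c) = 0 := by linear_combination -h
  rcases mul_eq_zero.1 h1 with h2 | h2
  · linarith
  · exact h2

theorem injOn_of_lt {S : Set ℝ} {P : ℝ → ℝ} (h : ∀ x ∈ S, ∀ y ∈ S, x < y → P x ≠ P y) : InjOn P S := by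
  intro x hx y hy hxy
  rcases lt_trichotomy x y with h1 | h1 | h1
  · exact absurd hxy (h x hx y hy h1)
  · exact h1
  · exact absurd hxy.symm (h y hy x hx h1)

theorem poly_bound (a b c d : ℝ) (κ : ℝ → ℝ≥0∞) :
    ∫⁻ x, ENNReal.ofReal |3 * a * x ^ 2 + 2 * b * x + c| *
      κ (a * x ^ 3 + b * x ^ 2 + c * x + d) ≤ 4 * ∫⁻ x, κ x := by
  set D : ℝ → ℝ := fun x => 3 * a * x ^ 2 + 2 * b * x + c with hD
  set E : ℝ → ℝ := fun x => 3 * a * x + b with hE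
  have mD : Measurable D := by fun_prop
  have mE : Measurable E := by fun_prop
  have m1 := (measurableSet_lt measurable_const mD : MeasurableSet {x | 0 < D x})
  have m2 := (measurableSet_lt mD measurable_const : MeasurableSet {x | D x < 0})
  have m3 := (measurableSet_le measurable_const mE : MeasurableSet {x | 0 ≤ E x})
  have m4 := (measurableSet_lt mE measurable_const : MeasurableSet {x | E x < 0})
  have m5 := (measurableSet_eq_fun mD measurable_const : MeasurableSet {x | D x = 0})
  set Φ : ℝ → ℝ≥0∞ := fun x => ENNReal.ofReal |3 * a * x ^ 2 + 2 * b * x + c| *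
      κ (a * x ^ 3 + b * x ^ 2 + c * x + d) with hΦ
  have key1 : ∀ x y : ℝ, a * (x ^ 2 + x * y + y ^ 2) + b * (x + y) + c
      = D x + (y - x) * (2 * E x + E y) / 3 := by
    intro x y; simp only [hD, hE]; ring
  have key2 : ∀ x y : ℝ, a * (x ^ 2 + x * y + y ^ 2) + b * (x + y) + c
      = D y - (y - x) * (2 * E y + E x) / 3 := by
    intro x y; simp only [hD, hE]; ring
  have i1 : ∫⁻ x in {x | 0 < D x} ∩ {x | 0 ≤ E x}, Φ x ≤ ∫⁻ x, κ x := by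
    refine poly_piece a b c d _ (m1.inter m3) (injOn_of_lt ?_) κ
    rintro x ⟨hx1, hx2⟩ y ⟨hy1, hy2⟩ hxy h
    have := poly_inj_aux a b c d x y hxy h
    simp only [mem_ofPred_eq] at *
    have h3 := key1 x y
    nlinarith [mul_nonneg (sub_nonneg.2 hxy.le) (by linarith : 0 ≤ 2 * E x + E y)]
  have i2 : ∫⁻ x in {x | 0 < D x} ∩ {x | E x < 0}, Φ x ≤ ∫⁻ x, κ x := by
    refine poly_piece a b c d _ (m1.inter m4) (injOn_of_lt ?_) κ
    rintro x ⟨hx1, hx2⟩ y ⟨hy1, hy2⟩ hxy h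
    have := poly_inj_aux a b c d x y hxy h
    simp only [mem_ofPred_eq] at *
    have h3 := key2 x y
    nlinarith [mul_nonneg (sub_nonneg.2 hxy.le) (by linarith : 0 ≤ -(2 * E y + E x))]
  have i3 : ∫⁻ x in {x | D x < 0} ∩ {x | 0 ≤ E x}, Φ x ≤ ∫⁻ x, κ x := by
    refine poly_piece a b c d _ (m2.inter m3) (injOn_of_lt ?_) κ
    rintro x ⟨hx1, hx2⟩ y ⟨hy1, hy2⟩ hxy h
    have := poly_inj_aux a b c d x y hxy h
    simp only [mem_ofPred_eq] at *
    have h3 := key2 x y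
    nlinarith [mul_nonneg (sub_nonneg.2 hxy.le) (by linarith : 0 ≤ (2 * E y + E x))]
  have i4 : ∫⁻ x in {x | D x < 0} ∩ {x | E x < 0}, Φ x ≤ ∫⁻ x, κ x := by
    refine poly_piece a b c d _ (m2.inter m4) (injOn_of_lt ?_) κ
    rintro x ⟨hx1, hx2⟩ y ⟨hy1, hy2⟩ hxy h
    have := poly_inj_aux a b c d x y hxy h
    simp only [mem_ofPred_eq] at *
    have h3 := key1 x y
    nlinarith [mul_nonneg (sub_nonneg.2 hxy.le) (by linarith : 0 ≤ -(2 * E x + E y))]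
  have i5 : ∫⁻ x in {x | D x = 0}, Φ x = 0 := by
    rw [← lintegral_zero (μ := volume.restrict {x | D x = 0})]
    apply setLIntegral_congr_fun m5
    intro x hx
    simp only [mem_ofPred_eq, hD] at hx
    simp only [hΦ, hx]
    simp
  have hu : (univ : Set ℝ) = ((({x | 0 < D x} ∩ {x | 0 ≤ E x}) ∪ ({x | 0 < D x} ∩ {x | E x < 0})) ∪
     (({x | D x < 0} ∩ {x | 0 ≤ E x}) ∪ ({x | D x < 0} ∩ {x | E x < 0}))) ∪ {x | D x = 0} := by
    ext x
    simp only [mem_univ, mem_union, mem_inter_iff, mem_ofPred_eq, true_iff]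
    rcases lt_trichotomy (D x) 0 with h | h | h <;> rcases lt_or_ge (E x) 0 with h' | h' <;> simp [h, h']
  calc ∫⁻ x, Φ x = ∫⁻ x in univ, Φ x := by simp
    _ ≤ (((∫⁻ x, κ x) + (∫⁻ x, κ x)) + ((∫⁻ x, κ x) + (∫⁻ x, κ x))) + 0 := by
      rw [hu]
      refine (lintegral_union_le _ _ _).trans (add_le_add ?_ i5.le)
      refine (lintegral_union_le _ _ _).trans (add_le_add ?_ ?_)
      · exact (lintegral_union_le _ _ _).trans (add_le_add i1 i2)
      · exact (lintegral_union_le _ _ _).trans (add_le_add i3 i4)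
    _ = 4 * ∫⁻ x, κ x := by ring

theorem core (K A B : ℝ × ℝ → ℝ≥0∞) (hK : Measurable K) (hA : Measurable A) (hB : Measurable B)
    (φ₁ φ₂ : ℝ → ℝ) (h₁ : Measurable φ₁) (h₂ : Measurable φ₂)
    (M : ℝ → ℝ → ℝ≥0∞) (hM : Measurable (Function.uncurry M))
    (r r' : ℝ → ℝ≥0∞) (hr : Measurable r) (hr' : Measurable r') (hrr : ∀ x, r x * r' x = 1)
    (W : ℝ≥0∞) (hW : ∫⁻ x, r' x ^ 2 = W)
    (h1d : ∀ ζ s, ∫⁻ η, M (η + ζ) η ^ 2 * r' (s + φ₁ (η + ζ) - φ₂ η) ^ 2 ≤ 4 * W) :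
    ∫⁻ z : (ℝ × ℝ) × (ℝ × ℝ), M z.1.1 z.2.1 * K (z.1 - z.2) * A z.1 * B z.2 ≤
      2 * W * (∫⁻ p, K p ^ 2) ^ (1/2 : ℝ) *
        (∫⁻ p : ℝ × ℝ, A p ^ 2 * r (p.2 + φ₁ p.1) ^ 2) ^ (1/2 : ℝ) *
        (∫⁻ p : ℝ × ℝ, B p ^ 2 * r (p.2 + φ₂ p.1) ^ 2) ^ (1/2 : ℝ) := by
  have hM' : Measurable fun z : (ℝ × ℝ) × (ℝ × ℝ) => M z.1.1 z.2.1 :=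
    hM.comp (by fun_prop : Measurable fun z : (ℝ × ℝ) × (ℝ × ℝ) => (z.1.1, z.2.1))
  set X : (ℝ × ℝ) × (ℝ × ℝ) → ℝ≥0∞ := fun z =>
    M z.1.1 z.2.1 * K (z.1 - z.2) * r' (z.1.2 + φ₁ z.1.1) * r' (z.2.2 + φ₂ z.2.1) with hX
  set Y : (ℝ × ℝ) × (ℝ × ℝ) → ℝ≥0∞ := fun z =>
    (A z.1 * r (z.1.2 + φ₁ z.1.1)) * (B z.2 * r (z.2.2 + φ₂ z.2.1)) with hY
  have mX : Measurable X := by fun_prop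
  have mY : Measurable Y := by fun_prop
  have e : ∫⁻ z : (ℝ × ℝ) × (ℝ × ℝ), M z.1.1 z.2.1 * K (z.1 - z.2) * A z.1 * B z.2
      = ∫⁻ z, (X * Y) z := by
    congr 1; ext z
    simp only [hX, hY, Pi.mul_apply]
    calc _ = M z.1.1 z.2.1 * K (z.1 - z.2) * A z.1 * B z.2 * (r (z.1.2 + φ₁ z.1.1) * r' (z.1.2 + φ₁ z.1.1)) * (r (z.2.2 + φ₂ z.2.1) * r' (z.2.2 + φ₂ z.2.1)) := by
            rw [hrr, hrr]; ring
      _ = _ := by ring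
  have cs := ENNReal.lintegral_mul_le_Lp_mul_Lq volume Real.HolderConjugate.two_two mX.aemeasurable mY.aemeasurable
  rw [← e] at cs
  simp only [ENNReal.rpow_two] at cs
  have eY : ∫⁻ z, Y z ^ 2 = (∫⁻ p : ℝ × ℝ, A p ^ 2 * r (p.2 + φ₁ p.1) ^ 2) *
      (∫⁻ p : ℝ × ℝ, B p ^ 2 * r (p.2 + φ₂ p.1) ^ 2) := by
    rw [Measure.volume_eq_prod (ℝ × ℝ) (ℝ × ℝ), ← lintegral_prod_mul (by fun_prop) (by fun_prop)]
    simp only [hY, mul_pow]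
  have eX : ∫⁻ z, X z ^ 2 ≤ (2 * W) ^ 2 * ∫⁻ p, K p ^ 2 := by
    rw [Measure.volume_eq_prod (ℝ × ℝ) (ℝ × ℝ), lintegral_prod_symm' _ (by fun_prop)]
    have s1 : ∀ q : ℝ × ℝ, ∫⁻ p, X (p, q) ^ 2 = ∫⁻ p, X (p + q, q) ^ 2 := fun q =>
      (lintegral_add_right_eq_self (fun p => X (p, q) ^ 2) q).symm
    simp only [s1]
    have mX2 : Measurable (fun z : (ℝ × ℝ) × (ℝ × ℝ) => X (z.2 + z.1, z.1) ^ 2) := by fun_prop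
    rw [lintegral_lintegral_swap mX2.aemeasurable, ← lintegral_const_mul _ (by fun_prop)]
    apply lintegral_mono
    intro p
    have mm : Measurable fun q : ℝ × ℝ => M (q.1 + p.1) q.1 :=
      hM.comp (by fun_prop : Measurable fun q : ℝ × ℝ => (q.1 + p.1, q.1))
    have s2 : ∀ q : ℝ × ℝ, X (p + q, q) ^ 2 = K p ^ 2 * (M (q.1 + p.1) q.1 ^ 2 *
        r' (p.2 + q.2 + φ₁ (q.1 + p.1)) ^ 2 * r' (q.2 + φ₂ q.1) ^ 2) := by
      intro q
      simp only [hX, Prod.fst_add, Prod.snd_add, add_sub_cancel_right, mul_pow, add_comm q.1]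
      ring
    simp only [s2]
    rw [lintegral_const_mul _ (by fun_prop), mul_comm]
    gcongr
    rw [Measure.volume_eq_prod, lintegral_prod _ (by fun_prop)]
    have s3 : ∀ η : ℝ, ∫⁻ t, M (η + p.1) η ^ 2 * r' (p.2 + t + φ₁ (η + p.1)) ^ 2 * r' (t + φ₂ η) ^ 2
       = ∫⁻ t, r' t ^ 2 * (M (η + p.1) η ^ 2 * r' ((p.2 + t) + φ₁ (η + p.1) - φ₂ η) ^ 2) := by
      intro η
      rw [← lintegral_sub_right_eq_self _ (φ₂ η)]
      congr 1; ext t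
      rw [sub_add_cancel, mul_comm, show p.2 + (t - φ₂ η) + φ₁ (η + p.1) = (p.2 + t) + φ₁ (η + p.1) - φ₂ η by ring]
    simp only [s3]
    have mZ : Measurable (fun z : ℝ × ℝ => r' z.2 ^ 2 * (M (z.1 + p.1) z.1 ^ 2 * r' ((p.2 + z.2) + φ₁ (z.1 + p.1) - φ₂ z.1) ^ 2)) := by fun_prop
    rw [lintegral_lintegral_swap mZ.aemeasurable]
    calc _ = ∫⁻ t, r' t ^ 2 * ∫⁻ η, (M (η + p.1) η ^ 2 * r' ((p.2 + t) + φ₁ (η + p.1) - φ₂ η) ^ 2) := by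
            congr 1; ext t
            rw [lintegral_const_mul]
            have : Measurable fun η : ℝ => M (η + p.1) η :=
              hM.comp (by fun_prop : Measurable fun η : ℝ => (η + p.1, η))
            fun_prop
      _ ≤ ∫⁻ t, r' t ^ 2 * (4 * W) := by
            gcongr with t
            exact h1d _ _
      _ = (2 * W) ^ 2 := by
            rw [lintegral_mul_const _ (by fun_prop), hW]; ring
  refine cs.trans ?_
  rw [eY, ENNReal.mul_rpow_of_nonneg _ _ (by norm_num : (0:ℝ) ≤ 1/2), ← mul_assoc]
  gcongr
  calc _ ≤ ((2 * W) ^ 2 * ∫⁻ p, K p ^ 2) ^ (1/2 : ℝ) := by gcongr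
    _ = _ := by
      rw [ENNReal.mul_rpow_of_nonneg _ _ (by norm_num : (0:ℝ) ≤ 1/2), ← ENNReal.rpow_two, ← ENNReal.rpow_mul]
      norm_num

theorem jb_pos (a : ℝ) : 0 < jb a := Real.sqrt_pos.2 (by positivity)

theorem jb_cont : Continuous jb := by unfold jb; fun_prop

theorem jb_neg (a : ℝ) : jb (-a) = jb a := by simp [jb]

theorem W_fin (ε : ℝ) (hε : 0 < ε) :
    ∫⁻ x : ℝ, ENNReal.ofReal (jb x ^ (-(1/2 + ε))) ^ 2 < ⊤ := by
  have h := integrable_rpow_neg_one_add_norm_sq (E := ℝ) (μ := volume) (r := 1 + 2 * ε) (by simp; linarith)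
  have h2 := h.lintegral_lt_top
  refine lt_of_le_of_lt (lintegral_mono fun x => ?_) h2
  rw [← ENNReal.ofReal_pow (Real.rpow_nonneg (jb_pos x).le _)]
  apply ENNReal.ofReal_le_ofReal
  apply le_of_eq
  rw [jb, Real.sqrt_eq_rpow, ← Real.rpow_mul (by positivity), ← Real.rpow_natCast, ← Real.rpow_mul (by positivity), Real.norm_eq_abs, sq_abs]
  congr 1
  push_cast
  ring

theorem XNorm_eq (φ : ℝ → ℝ) (b : ℝ) (f : ℝ × ℝ → ℂ) :
    XNorm φ 0 b f = (∫⁻ p : ℝ × ℝ, ‖FT2 f p‖ₑ ^ 2 * ENNReal.ofReal (jb (p.2 + φ p.1) ^ b) ^ 2) ^ (1/2 : ℝ) := by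
  unfold XNorm
  congr 2
  ext p
  rw [← ENNReal.ofReal_pow (Real.rpow_nonneg (jb_pos _).le _), ← ofReal_norm,
    ← ENNReal.ofReal_pow (norm_nonneg _), ← ENNReal.ofReal_mul (by positivity)]
  congr 1
  rw [mul_zero, Real.rpow_zero, ← Real.rpow_natCast (jb _ ^ b), ← Real.rpow_mul (jb_pos _).le, mul_comm 2 b]
  push_cast
  ring

theorem K_le (f : ℝ × ℝ → ℂ) : (∫⁻ p, ‖FT2 f p‖ₑ ^ 2) ^ (1/2 : ℝ) ≤ eLpNorm f 2 volume := by
  refine le_trans (le_of_eq ?_) (FT2_planch f)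
  rw [eLpNorm_eq_lintegral_rpow_enorm_toReal (by norm_num) (by norm_num)]
  simp

theorem Itri_le (m : ℝ → ℝ → ℝ) (F G H : ℝ × ℝ → ℂ) :
    Itri m F G H ≤ ∫⁻ q : (ℝ × ℝ) × (ℝ × ℝ), ‖m q.1.1 q.2.1‖ₑ * ‖F (q.1 + q.2)‖ₑ * ‖G q.1‖ₑ * ‖H q.2‖ₑ := by
  unfold Itri
  apply lintegral_mono
  intro q
  have hre : ∀ z : ℂ, ‖z.re‖ₑ ≤ ‖z‖ₑ := fun z => by
    rw [← ofReal_norm, ← ofReal_norm]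
    exact ENNReal.ofReal_le_ofReal (Complex.abs_re_le_norm z)
  refine (Real.ofReal_le_enorm _).trans ?_
  rw [enorm_mul, enorm_mul, enorm_mul]
  exact mul_le_mul' (mul_le_mul' (mul_le_mul' le_rfl (hre _)) (hre _)) (hre _)

theorem sqw (a : ℝ) : ‖|a| ^ ((1:ℝ)/2)‖ₑ ^ 2 = ENNReal.ofReal |a| := by
  rw [Real.enorm_of_nonneg (by positivity), ← ENNReal.ofReal_pow (by positivity), ← Real.sqrt_eq_rpow, Real.sq_sqrt (abs_nonneg a)]

theorem poly_bound' {u : ℝ → ℝ≥0∞} {W : ℝ≥0∞} (hW : ∫⁻ x, u x ^ 2 = W) (a b c d : ℝ)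
    (D P : ℝ → ℝ) (hD : ∀ x, |D x| ≤ |3 * a * x ^ 2 + 2 * b * x + c|)
    (hP : ∀ x, P x = a * x ^ 3 + b * x ^ 2 + c * x + d) :
    ∫⁻ x, ‖|D x| ^ ((1:ℝ)/2)‖ₑ ^ 2 * u (P x) ^ 2 ≤ 4 * W := by
  rw [← hW]
  refine le_trans (lintegral_mono fun x => ?_) (poly_bound a b c d (fun x => u x ^ 2))
  rw [sqw, hP]
  exact mul_le_mul' (ENNReal.ofReal_le_ofReal (hD x)) le_rfl

theorem shift1 (Φ : (ℝ × ℝ) × (ℝ × ℝ) → ℝ≥0∞) (h : Measurable Φ) :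
    ∫⁻ z, Φ z = ∫⁻ z : (ℝ × ℝ) × (ℝ × ℝ), Φ (z.1 - z.2, z.2) := by
  rw [Measure.volume_eq_prod (ℝ × ℝ) (ℝ × ℝ), lintegral_prod_symm' _ h, lintegral_prod_symm' _ (by fun_prop)]
  congr 1; ext q
  exact (lintegral_sub_right_eq_self (fun p => Φ (p, q)) q).symm

theorem shift2 (Φ : (ℝ × ℝ) × (ℝ × ℝ) → ℝ≥0∞) (h : Measurable Φ) :
    ∫⁻ z, Φ z = ∫⁻ z : (ℝ × ℝ) × (ℝ × ℝ), Φ (z.2, z.1 - z.2) := by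
  rw [Measure.volume_eq_prod (ℝ × ℝ) (ℝ × ℝ), lintegral_prod _ h.aemeasurable, lintegral_prod_symm' _ (by fun_prop)]
  congr 1; ext q
  exact (lintegral_sub_right_eq_self (fun p => Φ (q, p)) q).symm

theorem shift3 (Φ : (ℝ × ℝ) × (ℝ × ℝ) → ℝ≥0∞) (h : Measurable Φ) :
    ∫⁻ z, Φ z = ∫⁻ z : (ℝ × ℝ) × (ℝ × ℝ), Φ (z.1, -z.2) := by
  rw [Measure.volume_eq_prod (ℝ × ℝ) (ℝ × ℝ), lintegral_prod _ h.aemeasurable, lintegral_prod _ (by fun_prop)]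
  congr 1; ext q
  exact (lintegral_neg_eq_self (fun p => Φ (q, p))).symm

/-- the trilinear estimates for `I^{1/2}_4`, `I^{1/2}_5`, `I^{1/2}_6`. -/
theorem stmt3 (ε : ℝ) (hε : 0 < ε) :
    ∃ C : ℝ, 0 < C ∧
      ∀ f g h : ℝ × ℝ → ℂ, HasNonnegFT f → HasNonnegFT g → HasNonnegFT h →
        (Itri (fun ξ₁ ξ₂ => |ξ₁ + ξ₂| ^ ((1:ℝ)/2)) (FT2 f) (FT2 g) (FT2 h) ≤
            ENNReal.ofReal C * eLpNorm f 2 volume * XNorm SchPhase 0 (1/2 + ε) g *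
              XNorm SchPhaseNeg 0 (1/2 + ε) h) ∧
        (Itri (fun ξ₁ ξ₂ => |3 * (ξ₁ + ξ₂) ^ 2 - 2 * ξ₂| ^ ((1:ℝ)/2)) (FT2 f) (FT2 g) (FT2 h) ≤
            ENNReal.ofReal C * XNorm AiryPhase 0 (1/2 + ε) f * eLpNorm g 2 volume *
              XNorm SchPhaseNeg 0 (1/2 + ε) h) ∧
        (Itri (fun ξ₁ ξ₂ => |3 * (ξ₁ + ξ₂) ^ 2 + 2 * ξ₁| ^ ((1:ℝ)/2)) (FT2 f) (FT2 g) (FT2 h) ≤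
            ENNReal.ofReal C * XNorm AiryPhase 0 (1/2 + ε) f * XNorm SchPhase 0 (1/2 + ε) g *
              eLpNorm h 2 volume) := by
  set W := ∫⁻ x : ℝ, ENNReal.ofReal (jb x ^ (-(1/2 + ε))) ^ 2 with hW
  have hWf : W < ⊤ := W_fin ε hε
  have hC : 2 * W ≤ ENNReal.ofReal (2 * W.toReal + 1) := by
    rw [ENNReal.ofReal_add (by positivity) (by norm_num), ENNReal.ofReal_mul (by norm_num), ENNReal.ofReal_toReal hWf.ne]
    simp
  refine ⟨2 * W.toReal + 1, by positivity, ?_⟩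
  intro f g h _ _ _
  have mr : Measurable fun x => ENNReal.ofReal (jb x ^ (1/2 + ε)) :=
    (jb_cont.measurable.pow_const _).ennreal_ofReal
  have mr' : Measurable fun x => ENNReal.ofReal (jb x ^ (-(1/2 + ε))) :=
    (jb_cont.measurable.pow_const _).ennreal_ofReal
  have hrr : ∀ x, ENNReal.ofReal (jb x ^ (1/2 + ε)) * ENNReal.ofReal (jb x ^ (-(1/2 + ε))) = 1 := by
    intro x
    rw [← ENNReal.ofReal_mul (Real.rpow_nonneg (jb_pos x).le _), ← Real.rpow_add (jb_pos x)]
    simp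
  have mf0 := (FT2_cont f).measurable
  have mg0 := (FT2_cont g).measurable
  have mh0 := (FT2_cont h).measurable
  have mf : Measurable fun p => ‖FT2 f p‖ₑ := (FT2_cont f).measurable.enorm
  have mg : Measurable fun p => ‖FT2 g p‖ₑ := (FT2_cont g).measurable.enorm
  have mh : Measurable fun p => ‖FT2 h p‖ₑ := (FT2_cont h).measurable.enorm
  have mS : Measurable SchPhase := by unfold SchPhase; fun_prop
  have mN : Measurable SchPhaseNeg := by unfold SchPhaseNeg; fun_prop
  have mA : Measurable AiryPhase := by unfold AiryPhase; fun_prop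
  refine ⟨?_, ?_, ?_⟩
  · refine (Itri_le _ _ _ _).trans ?_
    rw [shift3 _ (by fun_prop)]
    have c := core (fun p => ‖FT2 f p‖ₑ) (fun p => ‖FT2 g p‖ₑ) (fun p => ‖FT2 h (-p)‖ₑ) mf mg
      (mh.comp measurable_neg) SchPhase SchPhase mS mS (fun ξ η => ‖|ξ - η| ^ ((1:ℝ)/2)‖ₑ)
      (by unfold Function.uncurry; fun_prop) _ _ mr mr' hrr W hW.symm (by
        intro ζ s
        refine poly_bound' hW.symm 0 0 (2 * ζ) (s + ζ ^ 2) (fun η => η + ζ - η) _ ?_ ?_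
        · intro x
          simp [abs_mul]
          linarith [abs_nonneg ζ]
        · intro x
          simp only [SchPhase]; ring)
    simp only [Prod.fst_neg, ← sub_eq_add_neg]
    refine c.trans ?_
    rw [← XNorm_eq]
    have e : (∫⁻ p : ℝ × ℝ, ‖FT2 h (-p)‖ₑ ^ 2 * ENNReal.ofReal (jb (p.2 + SchPhase p.1) ^ (1/2 + ε)) ^ 2) ^ (1/2 : ℝ)
        = XNorm SchPhaseNeg 0 (1/2 + ε) h := by
      rw [XNorm_eq, ← lintegral_neg_eq_self]
      congr 2
      ext p
      rw [← jb_neg]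
      simp [SchPhase, SchPhaseNeg]
      ring_nf
    rw [e]
    gcongr
    exact K_le f
  · refine (Itri_le _ _ _ _).trans ?_
    rw [shift1 _ (by fun_prop)]
    have c := core (fun p => ‖FT2 g p‖ₑ) (fun p => ‖FT2 f p‖ₑ) (fun p => ‖FT2 h p‖ₑ) mg mf
      mh AiryPhase SchPhaseNeg mA mN (fun ξ η => ‖|3 * ξ ^ 2 - 2 * η| ^ ((1:ℝ)/2)‖ₑ)
      (by unfold Function.uncurry; fun_prop) _ _ mr mr' hrr W hW.symm (by
        intro ζ s
        refine poly_bound' hW.symm (-1) (-3 * ζ + 1) (-3 * ζ ^ 2) (s - ζ ^ 3) (fun η => 3 * (η + ζ) ^ 2 - 2 * η) _ ?_ ?_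
        · intro x
          rw [← abs_neg]
          apply le_of_eq
          congr 1
          ring
        · intro x
          simp only [SchPhaseNeg, AiryPhase]; ring)
    rw [← XNorm_eq, ← XNorm_eq] at c
    have e : ∀ z : (ℝ × ℝ) × (ℝ × ℝ), ‖|3 * ((z.1 - z.2).1 + z.2.1) ^ 2 - 2 * z.2.1| ^ ((1:ℝ)/2)‖ₑ *
        ‖FT2 f (z.1 - z.2 + z.2)‖ₑ * ‖FT2 g (z.1 - z.2)‖ₑ * ‖FT2 h z.2‖ₑ =
        ‖|3 * z.1.1 ^ 2 - 2 * z.2.1| ^ ((1:ℝ)/2)‖ₑ * ‖FT2 g (z.1 - z.2)‖ₑ * ‖FT2 f z.1‖ₑ * ‖FT2 h z.2‖ₑ := by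
      intro z
      rw [Prod.fst_sub, sub_add_cancel, sub_add_cancel]
      ring
    simp only [e]
    refine c.trans ?_
    rw [mul_right_comm (ENNReal.ofReal _)]
    gcongr
    exact K_le g
  · refine (Itri_le _ _ _ _).trans ?_
    rw [shift2 _ (by fun_prop)]
    have c := core (fun p => ‖FT2 h p‖ₑ) (fun p => ‖FT2 f p‖ₑ) (fun p => ‖FT2 g p‖ₑ) mh mf
      mg AiryPhase SchPhase mA mS (fun ξ η => ‖|3 * ξ ^ 2 + 2 * η| ^ ((1:ℝ)/2)‖ₑ)
      (by unfold Function.uncurry; fun_prop) _ _ mr mr' hrr W hW.symm (by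
        intro ζ s
        refine poly_bound' hW.symm (-1) (-3 * ζ - 1) (-3 * ζ ^ 2) (s - ζ ^ 3) (fun η => 3 * (η + ζ) ^ 2 + 2 * η) _ ?_ ?_
        · intro x
          rw [← abs_neg]
          apply le_of_eq
          congr 1
          ring
        · intro x
          simp only [SchPhase, AiryPhase]; ring)
    rw [← XNorm_eq, ← XNorm_eq] at c
    have e : ∀ z : (ℝ × ℝ) × (ℝ × ℝ), ‖|3 * (z.2.1 + (z.1 - z.2).1) ^ 2 + 2 * z.2.1| ^ ((1:ℝ)/2)‖ₑ *
        ‖FT2 f (z.2 + (z.1 - z.2))‖ₑ * ‖FT2 g z.2‖ₑ * ‖FT2 h (z.1 - z.2)‖ₑ =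
        ‖|3 * z.1.1 ^ 2 + 2 * z.2.1| ^ ((1:ℝ)/2)‖ₑ * ‖FT2 h (z.1 - z.2)‖ₑ * ‖FT2 f z.1‖ₑ * ‖FT2 g z.2‖ₑ := by
      intro z
      rw [Prod.fst_sub, add_sub_cancel, add_sub_cancel]
      ring
    simp only [e]
    refine c.trans ?_
    calc _ = 2 * W * XNorm AiryPhase 0 (1/2 + ε) f * XNorm SchPhase 0 (1/2 + ε) g *
          (∫⁻ p, ‖FT2 h p‖ₑ ^ 2) ^ (1/2 : ℝ) := by ring
      _ ≤ _ := by
        gcongr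
        exact K_le h

end
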